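/- Let R be a commutative noetherian ring. If the formal power series ring R⟦X⟧ satisfies Auslander's condition (AC), then R satisfies (AC). -/

import Mathlib

open CategoryTheory

universe u

noncomputable abbrev ExtGroup {A : Type u} [Ring A] (M N : ModuleCat.{u} A) (i : ℕ) :=
  ((Ext ℤ (ModuleCat.{u} A) i).obj (Opposite.op M)).obj N

/-- Auslander's condition (AC). -/
def SatisfiesAC (A : Type u) [Ring A] : Prop :=
  ∀ M : ModuleCat.{u} A, Module.Finite A M →
    ∃ b : ℕ, ∀ N : ModuleCat.{u} A, Module.Finite A N →
      (∃ n : ℕ, ∀ i ≥ n, Subsingleton (ExtGroup M N i)) →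
      ∀ i > b, Subsingleton (ExtGroup M N i)

namespace CategoryTheory.Adjunction

universe v u₁ u₂

variable {C : Type u₁} {D : Type u₂} [Category.{v} C] [Category.{v} D] [Abelian C] [Abelian D]
  [Linear ℤ C] [Linear ℤ D] {F : C ⥤ D} {G : D ⥤ C} [F.Additive]

/-- The complexes `Hom(F(K), Y)` and `Hom(K, G(Y))` attached to an adjunction `F ⊣ G` are
isomorphic. -/
noncomputable def linearYonedaObjIso (adj : F ⊣ G) (K : ChainComplex C ℕ) (Y : D) :
    ChainComplex.linearYonedaObj ((F.mapHomologicalComplex _).obj K) ℤ Y ≅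
      K.linearYonedaObj ℤ (G.obj Y) :=
  HomologicalComplex.Hom.isoOfComponents
    (fun i ↦ ((adj.homAddEquiv (K.X i) Y).toIntLinearEquiv).toModuleIso) fun i j _ ↦
      ModuleCat.hom_ext <| LinearMap.ext fun g ↦
        (adj.homEquiv_naturality_left (K.d j i) g).symm

/-- If `F ⊣ G`, where `F` is exact and `G` preserves epimorphisms, then
`Ext(F(X), Y) ≅ Ext(X, G(Y))`. -/
noncomputable def extIso [EnoughProjectives C] [EnoughProjectives D] [F.PreservesHomology]
    [G.PreservesEpimorphisms] (adj : F ⊣ G) (X : C) (Y : D) (n : ℕ) :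
    ((Ext ℤ D n).obj (Opposite.op (F.obj X))).obj Y ≅
      ((Ext ℤ C n).obj (Opposite.op X)).obj (G.obj Y) :=
  have := F.preservesProjectiveObjects_of_adjunction_of_preservesEpimorphisms adj
  let P := projectiveResolution X
  (F.mapProjectiveResolution P).isoExt n Y ≪≫
    (HomologicalComplex.homologyFunctor _ _ n).mapIso (adj.linearYonedaObjIso P.complex Y) ≪≫
    (P.isoExt n (G.obj Y)).symm

end CategoryTheory.Adjunction

/-- Over a noetherian ring, arbitrary powers of the ring are flat. -/
theorem Module.Flat.pi_self_of_isNoetherianRing (R ι : Type*) [CommRing R] [IsNoetherianRing R] :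
    Module.Flat R (ι → R) := by
  refine Module.Flat.of_forall_isTrivialRelation fun {l f x} hfx ↦ ?_
  let φ : (Fin l → R) →ₗ[R] R := Fintype.linearCombination R f
  obtain ⟨k, a, ha⟩ := Submodule.fg_iff_exists_fin_generating_family.mp
    (IsNoetherian.noetherian (LinearMap.ker φ))
  have hx (n : ι) : ∃ c : Fin k → R, ∑ j, c j • a j = fun i ↦ x i n := by
    rw [← Submodule.mem_span_range_iff_exists_fun, ha]
    simpa [φ, Fintype.linearCombination_apply, mul_comm] using congrFun hfx n
  choose c hc using hx
  refine ⟨k, fun i j ↦ a j i, fun j n ↦ c n j, fun i ↦ ?_, fun j ↦ ?_⟩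
  · ext n
    simpa [mul_comm] using (congrFun (hc n) i).symm
  · have : a j ∈ LinearMap.ker φ := ha ▸ Submodule.subset_span ⟨j, rfl⟩
    simpa [φ, Fintype.linearCombination_apply, mul_comm] using this

instance PowerSeries.instFlat (R : Type*) [CommRing R] [IsNoetherianRing R] :
    Module.Flat R (PowerSeries R) :=
  Module.Flat.pi_self_of_isNoetherianRing R (Unit →₀ ℕ)

/-- Restriction of scalars along a surjective ring homomorphism preserves finite modules. -/
theorem ModuleCat.finite_restrictScalars_of_surjective {R S : Type u} [Ring R] [Ring S]
    {g : S →+* R} (hg : Function.Surjective g) (N : ModuleCat.{u} R) [Module.Finite R N] :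
    Module.Finite S ((ModuleCat.restrictScalars g).obj N) := by
  obtain ⟨s, hs⟩ := Module.Finite.fg_top (R := R) (M := N)
  refine ⟨⟨s, eq_top_iff.2 fun (x : N) _ ↦ ?_⟩⟩
  refine Submodule.span_induction (R := R) (s := (s : Set N))
    (p := fun y _ ↦ y ∈ Submodule.span S (M := (ModuleCat.restrictScalars g).obj N) (s : Set N))
    (fun _ hy ↦ Submodule.subset_span hy) (Submodule.zero_mem _)
    (fun _ _ _ _ hy hz ↦ Submodule.add_mem _ hy hz) (fun r y _ hy ↦ ?_)
    (hs ▸ Submodule.mem_top : x ∈ Submodule.span R (s : Set N))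
  obtain ⟨t, rfl⟩ := hg r
  exact Submodule.smul_mem _ t hy

/-- Auslander's condition descends along a flat ring homomorphism admitting a retraction. -/
theorem SatisfiesAC.of_flat_of_comp_eq_id {R S : Type u} [CommRing R] [CommRing S]
    {f : R →+* S} {g : S →+* R} (hf : f.Flat) (hgf : g.comp f = RingHom.id R)
    (h : SatisfiesAC S) : SatisfiesAC R := by
  intro M _
  let F := ModuleCat.extendScalars.{u, u, u} f
  let adj := ModuleCat.extendRestrictScalarsAdj.{u, u, u} f
  have : F.Additive := adj.left_adjoint_additive
  have : Limits.PreservesFiniteLimits F := ModuleCat.preservesFiniteLimits_extendScalars_of_flat hf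
  have : Limits.PreservesFiniteColimits F := by
    have := adj.leftAdjoint_preservesColimits
    infer_instance
  have hFM : Module.Finite S (F.obj M) := by
    algebraize [f]
    exact inferInstanceAs (Module.Finite S (TensorProduct R S M))
  obtain ⟨b, hb⟩ := h (F.obj M) hFM
  refine ⟨b, fun N _ ⟨n, hn⟩ ↦ ?_⟩
  let N' : ModuleCat S := (ModuleCat.restrictScalars g).obj N
  have hN' : Module.Finite S N' :=
    ModuleCat.finite_restrictScalars_of_surjective
      (fun r ↦ ⟨f r, RingHom.congr_fun hgf r⟩) N
  let e : (ModuleCat.restrictScalars f).obj N' ≅ N :=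
    (ModuleCat.restrictScalarsComp f g).symm.app N ≪≫ ModuleCat.restrictScalarsId'App _ hgf N
  have key (i : ℕ) : Subsingleton (ExtGroup (F.obj M) N' i) ↔ Subsingleton (ExtGroup M N i) :=
    (adj.extIso M N' i ≪≫
      ((Ext ℤ _ i).obj (.op M)).mapIso e).toLinearEquiv.toEquiv.subsingleton_congr
  exact fun i hi ↦ (key i).1 (hb N' hN' ⟨n, fun j hj ↦ (key j).2 (hn j hj)⟩ i hi)

/-- If the formal power series ring `R⟦X⟧` over a commutative noetherian ring `R`
satisfies (AC), then so does `R`. -/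
theorem stmt15 (R : Type u) [CommRing R] [IsNoetherianRing R]
    (h : SatisfiesAC (PowerSeries R)) : SatisfiesAC R :=
  h.of_flat_of_comp_eq_id (f := algebraMap R (PowerSeries R)) (g := PowerSeries.constantCoeff)
    (RingHom.flat_algebraMap_iff.2 inferInstance) (by ext; simp)
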